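/- Let E be a field of characteristic different from 2 and let E'/E be an algebraic field extension such that every element of E' has odd degree over E (i.e., E' is a direct limit of finite extensions of E of odd degree). If every square-free polynomial in E'[X] is square-reflexive over E', then every square-free polynomial in E[X] is square-reflexive over E. -/

import Mathlib

open Polynomial

/-- `f` is square-reflexive over `K`. -/
def IsSquareReflexive {K : Type*} [Field K] (f : Polynomial K) : Prop :=
  Squarefree f ∧
  ∀ α : (Polynomial K ⧸ Ideal.span {f})ˣ,
    (∃ u : Kˣ, Algebra.norm K (α : Polynomial K ⧸ Ideal.span {f}) = (u : K) ^ 2 ∨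
               Algebra.norm K (α : Polynomial K ⧸ Ideal.span {f}) = f.leadingCoeff * (u : K) ^ 2) →
    ∃ g : Polynomial K, IsCoprime f g ∧
      (∃ β : (Polynomial K ⧸ Ideal.span {f})ˣ,
        Ideal.Quotient.mk (Ideal.span {f}) g
          = (α : Polynomial K ⧸ Ideal.span {f}) * (β : Polynomial K ⧸ Ideal.span {f}) ^ 2) ∧
      IsSquare (Ideal.Quotient.mk (Ideal.span {g}) f)

theorem norm_formula {K L : Type*} [Field K] [Field L] [IsAlgClosed L] [Algebra K L] (f g : K[X]) (hf : f ≠ 0) :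
    algebraMap K L (Algebra.norm K (AdjoinRoot.mk f g)) =
     algebraMap K L g.leadingCoeff ^ f.natDegree *
      ((g.map (algebraMap K L)).roots.map (fun b => (-1) ^ f.natDegree * ((f.map (algebraMap K L)).eval b * (algebraMap K L f.leadingCoeff)⁻¹))).prod := by
  set b := (AdjoinRoot.powerBasis hf) with hb
  have hbd : b.dim = f.natDegree := by simp [hb]
  have hbg : b.gen = AdjoinRoot.root f := by simp [hb]
  set A := Algebra.leftMulMatrix b.basis (AdjoinRoot.root f) with hA
  have hchar : A.charpoly = f * C f.leadingCoeff⁻¹ := by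
    rw [hA, ← hbg, charpoly_leftMulMatrix, hbg, AdjoinRoot.minpoly_root hf]
  have h1 : Algebra.leftMulMatrix b.basis (AdjoinRoot.mk f g) = aeval A g := by
    rw [hA, ← AdjoinRoot.aeval_eq, ← Polynomial.aeval_algHom_apply]
  rw [Algebra.norm_eq_matrix_det b.basis, h1, RingHom.map_det]
  have h2 : (algebraMap K L).mapMatrix (aeval A g) = aeval (A.map (algebraMap K L)) (g.map (algebraMap K L)) := by
    rw [aeval_map_algebraMap]
    exact (Polynomial.aeval_algHom_apply (Algebra.ofId K L).mapMatrix A g).symm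
  rw [h2]
  have key : ∀ s : Multiset L, (aeval (A.map (algebraMap K L)) (s.map (fun a => X - C a)).prod).det
      = (s.map (fun b => (-1) ^ f.natDegree * ((f.map (algebraMap K L)).eval b * (algebraMap K L f.leadingCoeff)⁻¹))).prod := by
    intro s
    induction s using Multiset.induction with
    | empty => simp
    | cons a s ih =>
      rw [Multiset.map_cons, Multiset.prod_cons, map_mul, Matrix.det_mul, ih, Multiset.map_cons, Multiset.prod_cons]
      congr 1
      have h3 := Matrix.eval_charpoly (A.map (algebraMap K L)) a
      rw [Matrix.charpoly_map, hchar] at h3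
      have h4 : aeval (A.map (algebraMap K L)) (X - C a) = -(Matrix.scalar _ a - A.map (algebraMap K L)) := by
        simp [Matrix.algebraMap_eq_diagonal]
      rw [h4, Matrix.det_neg, ← h3]
      simp [hbd]
  have hs := (IsAlgClosed.splits (g.map (algebraMap K L))).eq_prod_roots
  conv_lhs => rw [hs]
  rw [map_mul, Matrix.det_mul, key]
  congr 1
  simp [Matrix.algebraMap_eq_diagonal, hbd]

theorem norm_map_poly {K L : Type*} [Field K] [Field L] [Algebra K L] (f g : K[X]) (hf : f ≠ 0) :
    algebraMap K L (Algebra.norm K (AdjoinRoot.mk f g)) = 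
     Algebra.norm L (AdjoinRoot.mk (f.map (algebraMap K L)) (g.map (algebraMap K L))) := by
  apply (algebraMap L (AlgebraicClosure L)).injective
  rw [norm_formula (L := AlgebraicClosure L) (f.map (algebraMap K L)) _ (by simpa using hf), ← IsScalarTower.algebraMap_apply, norm_formula _ _ hf]
  simp [Polynomial.map_map, ← IsScalarTower.algebraMap_eq, ← IsScalarTower.algebraMap_apply]

theorem norm_mul_poly {K : Type*} [Field K] (f₁ f₂ g : K[X]) (hf₁ : f₁ ≠ 0) (hf₂ : f₂ ≠ 0) :
    (Algebra.norm K (AdjoinRoot.mk (f₁ * f₂) g)) = 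
    (Algebra.norm K (AdjoinRoot.mk f₁ g)) * (Algebra.norm K (AdjoinRoot.mk f₂ g)) := by
  apply (algebraMap K (AlgebraicClosure K)).injective
  rw [map_mul, norm_formula _ _ (mul_ne_zero hf₁ hf₂), norm_formula _ _ hf₁, norm_formula _ _ hf₂,
    mul_mul_mul_comm, ← Multiset.prod_map_mul, natDegree_mul hf₁ hf₂, pow_add]
  congr 3
  funext b
  simp
  ring

theorem isSquare_of_odd {k K : Type*} [Field k] [Field K] [Algebra k K] (h : Odd (Module.finrank k K))
    (a : k) (ha : IsSquare (algebraMap k K a)) : IsSquare a := by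
  have : FiniteDimensional k K := FiniteDimensional.of_finrank_pos h.pos
  obtain ⟨y, hy⟩ := ha
  have hi : IsIntegral k y := IsIntegral.of_finite k y
  have h1 : minpoly k y ∣ X ^ 2 - C a := minpoly.dvd _ _ (by simp [hy, sq])
  have h2 : (minpoly k y).natDegree ∣ Module.finrank k K := minpoly.degree_dvd hi
  have h3 : (minpoly k y).natDegree ≤ 2 := by
    have := natDegree_le_of_dvd h1 (X_pow_sub_C_ne_zero two_pos a)
    simpa using this
  have h4 : Odd (minpoly k y).natDegree := h.of_dvd_nat h2
  have h5 : (minpoly k y).natDegree = 1 := by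
    interval_cases h : (minpoly k y).natDegree <;> simp_all (decide := true)
  obtain ⟨z, rfl⟩ := minpoly.natDegree_eq_one_iff.1 h5
  refine ⟨z, (algebraMap k K).injective ?_⟩
  rw [hy, map_mul]

theorem odd_finrank {E F : Type*} [Field E] [Field F] [Algebra E F] [FiniteDimensional E F]
    (hchar : ringChar E ≠ 2) (hodd : ∀ x : F, Odd ((minpoly E x).natDegree)) :
    Odd (Module.finrank E F) := by
  obtain ⟨q, hq⟩ := ExpChar.exists E
  have hq2 : Odd q := by
    cases hq with
    | zero => exact odd_one
    | prime hp =>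
      rename_i hc
      refine hp.odd_of_ne_two ?_
      rwa [← ringChar.eq E q]
  rw [← Module.finrank_mul_finrank E (separableClosure E F) F]
  refine Odd.mul ?_ ?_
  · obtain ⟨a, ha⟩ := Field.exists_primitive_element E (separableClosure E F)
    rw [← (Field.primitive_element_iff_minpoly_natDegree_eq E a).1 ha]
    have := hodd (a : F)
    rwa [show minpoly E (a : F) = minpoly E a from
      minpoly.algebraMap_eq (B' := F) (algebraMap (separableClosure E F) F).injective a] at this
  · have : ExpChar (separableClosure E F) q := expChar_of_injective_algebraMap (algebraMap E _).injective q
    obtain ⟨n, hn⟩ := IsPurelyInseparable.finrank_eq_pow (separableClosure E F) F q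
    rw [hn]
    exact hq2.pow

theorem odd_expChar {E : Type*} [Field E] (hchar : ringChar E ≠ 2) (q : ℕ) [hq : ExpChar E q] : Odd q := by
    cases hq with
    | zero => exact odd_one
    | prime hp =>
      rename_i hc
      refine hp.odd_of_ne_two ?_
      rwa [← ringChar.eq E q]

/-- multiplicities of roots of squarefree polynomials are odd -/
theorem odd_rootMultiplicity {E L : Type*} [Field E] [Field L] [Algebra E L] (hchar : ringChar E ≠ 2)
    (f : E[X]) (hf : Squarefree f) (b : L) (hb : (f.map (algebraMap E L)).IsRoot b) :
    Odd ((f.map (algebraMap E L)).rootMultiplicity b) := by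
  have hf0 : f ≠ 0 := hf.ne_zero
  have hfb : aeval b f = 0 := by simpa [IsRoot, eval_map_algebraMap] using hb
  have hint : IsIntegral E b := by
    rw [← isAlgebraic_iff_isIntegral]; exact ⟨f, hf0, hfb⟩
  set p := minpoly E b with hp
  have hirr : Irreducible p := minpoly.irreducible hint
  obtain ⟨r, hr⟩ := minpoly.dvd E b hfb
  obtain ⟨q, hq⟩ := ExpChar.exists E
  have : ExpChar L q := expChar_of_injective_algebraMap (algebraMap E L).injective q
  obtain ⟨h, hsep, m, hm⟩ := hirr.hasSeparableContraction q
  have hrb : ¬ (r.map (algebraMap E L)).IsRoot b := by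
    intro hrb
    have : p ∣ r := minpoly.dvd E b (by simpa [IsRoot, eval_map_algebraMap] using hrb)
    exact hirr.not_isUnit (hf p (by rw [hr]; exact mul_dvd_mul_left _ this))
  have hne : p.map (algebraMap E L) * r.map (algebraMap E L) ≠ 0 := by
    rw [← Polynomial.map_mul, ← hr]; simpa using hf0
  rw [hr, ← hp, Polynomial.map_mul, rootMultiplicity_mul hne, rootMultiplicity_eq_zero hrb, add_zero, ← hm,
    map_expand, rootMultiplicity_expand_pow]
  refine ((odd_expChar hchar q).pow).mul ?_
  have hs : (h.map (algebraMap E L)).Separable := hsep.map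
  have hroot : (h.map (algebraMap E L)).IsRoot (b ^ q ^ m) := by
    have : aeval b p = 0 := minpoly.aeval E b
    rw [← hm, expand_aeval] at this
    simpa [IsRoot, eval_map_algebraMap] using this
  have h1 := rootMultiplicity_le_one_of_separable hs (b ^ q ^ m)
  have h2 := (rootMultiplicity_pos hs.ne_zero).2 hroot
  rw [le_antisymm h1 h2]; exact odd_one

theorem exists_sq_mul_squarefree {K : Type*} [Field K] (n : ℕ) : ∀ F : K[X], F ≠ 0 → F.natDegree = n →
    ∃ f s : K[X], F = f * (s * s) ∧ Squarefree f ∧ s ≠ 0 := by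
  induction n using Nat.strong_induction_on with
  | _ n ih =>
    intro F hF hn
    by_cases hs : Squarefree F
    · exact ⟨F, 1, by simp, hs, one_ne_zero⟩
    · unfold Squarefree at hs
      push Not at hs
      obtain ⟨x, ⟨F1, h1⟩, hx⟩ := hs
      have hx0 : x ≠ 0 := by rintro rfl; simp at h1; exact hF h1
      have hF1 : F1 ≠ 0 := by rintro rfl; simp at h1; exact hF h1
      have hdeg : 0 < x.natDegree := natDegree_pos_iff_degree_pos.2 (degree_pos_of_ne_zero_of_nonunit hx0 hx)
      have h2 : F.natDegree = x.natDegree + x.natDegree + F1.natDegree := by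
        rw [h1, natDegree_mul (mul_ne_zero hx0 hx0) hF1, natDegree_mul hx0 hx0]
      obtain ⟨f, s, h3, h4, h5⟩ := ih F1.natDegree (by omega) F1 hF1 rfl
      exact ⟨f, x * s, by rw [h1, h3]; ring, h4, mul_ne_zero hx0 h5⟩

theorem exists_dvd_pow_of_odd {E K : Type*} [Field E] [Field K] [Algebra E K] (hchar : ringChar E ≠ 2)
    (f : E[X]) (hf : Squarefree f) (g s : K[X]) (hs : s ≠ 0) (hg : g ≠ 0)
    (h : f.map (algebraMap E K) = g * (s * s)) : ∃ n, f.map (algebraMap E K) ∣ g ^ n := by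
  classical
  have hF : f.map (algebraMap E K) ≠ 0 := by simpa using hf.ne_zero
  rw [UniqueFactorizationMonoid.exists_dvd_pow_iff_radical_dvd hF]
  rw [UniqueFactorizationMonoid.radical_dvd_iff_primeFactors_subset hg]
  intro π hπ
  rw [UniqueFactorizationMonoid.mem_primeFactors, UniqueFactorizationMonoid.mem_normalizedFactors_iff' hF] at hπ
  rw [UniqueFactorizationMonoid.mem_primeFactors, UniqueFactorizationMonoid.mem_normalizedFactors_iff' hg]
  obtain ⟨h1, h2, h3⟩ := hπ
  refine ⟨h1, h2, ?_⟩
  let L := AlgebraicClosure K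
  obtain ⟨b, hb⟩ := IsAlgClosed.exists_aeval_eq_zero L π (degree_pos_of_irreducible h1).ne'
  by_contra hπg
  have hcop : IsCoprime π g := (h1.coprime_iff_not_dvd).2 hπg
  have hgb : aeval b g ≠ 0 := by
    intro hgb
    obtain ⟨c, d, hcd⟩ := hcop
    have := congrArg (aeval b) hcd
    simp [hb, hgb] at this
  have hmap : f.map (algebraMap E L) = g.map (algebraMap K L) * (s.map (algebraMap K L) * s.map (algebraMap K L)) := by
    rw [IsScalarTower.algebraMap_eq E K L, ← Polynomial.map_map, h]; simp
  have hroot : (f.map (algebraMap E L)).IsRoot b := by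
    rw [IsScalarTower.algebraMap_eq E K L, ← Polynomial.map_map, IsRoot, eval_map_algebraMap]
    exact aeval_eq_zero_of_dvd_aeval_eq_zero h3 hb
  have hodd := odd_rootMultiplicity hchar f hf b hroot
  have hsL : s.map (algebraMap K L) ≠ 0 := by simpa using hs
  have hgL : g.map (algebraMap K L) ≠ 0 := by simpa using hg
  rw [hmap, rootMultiplicity_mul (mul_ne_zero hgL (mul_ne_zero hsL hsL)), rootMultiplicity_mul (mul_ne_zero hsL hsL),
    rootMultiplicity_eq_zero (by simpa [IsRoot, eval_map_algebraMap] using hgb), zero_add] at hodd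
  exact (Nat.not_odd_iff_even.2 ⟨_, rfl⟩) hodd

theorem mk_eq_iff {K : Type*} [Field K] (f a b : K[X]) :
   Ideal.Quotient.mk (Ideal.span {f}) a = Ideal.Quotient.mk (Ideal.span {f}) b ↔ f ∣ a - b := by
  rw [Ideal.Quotient.eq, Ideal.mem_span_singleton]

theorem isUnit_mk_iff {K : Type*} [Field K] (f a : K[X]) :
   IsUnit (Ideal.Quotient.mk (Ideal.span {f}) a) ↔ IsCoprime f a := by
  rw [isUnit_iff_exists_inv]
  constructor
  · rintro ⟨b, hb⟩
    obtain ⟨b, rfl⟩ := Ideal.Quotient.mk_surjective b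
    rw [← map_mul, ← map_one (Ideal.Quotient.mk _), mk_eq_iff] at hb
    obtain ⟨c, hc⟩ := hb
    exact ⟨-c, b, by linear_combination hc⟩
  · rintro ⟨c, d, h⟩
    refine ⟨Ideal.Quotient.mk _ d, ?_⟩
    rw [← map_mul, ← map_one (Ideal.Quotient.mk _), mk_eq_iff]
    exact ⟨-c, by linear_combination h⟩

theorem over_ext {E K : Type*} [Field E] [Field K] [Algebra E K] (hchar : ringChar E ≠ 2)
    (hsr : ∀ g : Polynomial K, Squarefree g → IsSquareReflexive g)
    (f : E[X]) (hf : Squarefree f) (a : E[X]) (ha : IsCoprime f a)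
    (hn : ∃ u : E, u ≠ 0 ∧ (Algebra.norm E (AdjoinRoot.mk f a) = u ^ 2 ∨
      Algebra.norm E (AdjoinRoot.mk f a) = f.leadingCoeff * u ^ 2)) :
    ∃ G β t y z c d : K[X], G = a.map (algebraMap E K) * β ^ 2 + f.map (algebraMap E K) * t ∧
      f.map (algebraMap E K) = y ^ 2 + G * z ∧ c * f.map (algebraMap E K) + d * G = 1 := by
  have h2E : (2 : K) ≠ 0 := by
    have : (2 : E) ≠ 0 := Ring.two_ne_zero hchar
    have h := (map_ne_zero (algebraMap E K)).2 this
    rwa [map_ofNat] at h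
  set F := f.map (algebraMap E K) with hFdef
  set A := a.map (algebraMap E K) with hAdef
  have hF : F ≠ 0 := by simpa [hFdef] using hf.ne_zero
  have hcop : IsCoprime F A := by
    simpa using ha.map (mapRingHom (algebraMap E K))
  obtain ⟨g, s, hgs, hg, hs⟩ := exists_sq_mul_squarefree _ F hF rfl
  have hg0 := hg.ne_zero
  obtain ⟨n, hFn⟩ := exists_dvd_pow_of_odd hchar f hf g s hs hg0 hgs
  rw [← hFdef] at hFn
  have hcop' : IsCoprime (g * (s * s)) A := hgs ▸ hcop
  have hcg : IsCoprime g A := hcop'.of_mul_left_left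
  have hcs : IsCoprime s A := hcop'.of_mul_left_right.of_mul_left_left
  have hNs : Algebra.norm K (AdjoinRoot.mk s A) ≠ 0 := by
    have h1 : IsUnit (AdjoinRoot.mk s A) := (isUnit_mk_iff s A).2 hcs
    exact (h1.map (Algebra.norm K)).ne_zero
  have hnorm : algebraMap E K (Algebra.norm E (AdjoinRoot.mk f a)) =
      Algebra.norm K (AdjoinRoot.mk g A) * (Algebra.norm K (AdjoinRoot.mk s A)) ^ 2 := by
    rw [norm_map_poly f a hf.ne_zero, ← hFdef, hgs, norm_mul_poly _ _ _ hg0 (mul_ne_zero hs hs),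
      norm_mul_poly _ _ _ hs hs, sq]
  have hlc : algebraMap E K f.leadingCoeff = g.leadingCoeff * s.leadingCoeff ^ 2 := by
    have : F.leadingCoeff = g.leadingCoeff * s.leadingCoeff ^ 2 := by
      rw [hgs, leadingCoeff_mul, leadingCoeff_mul, sq]
    rw [← this, hFdef, leadingCoeff_map]
  obtain ⟨α, hα⟩ := (isUnit_mk_iff g A).2 hcg
  obtain ⟨-, hsrg⟩ := hsr g hg
  have hslc : s.leadingCoeff ≠ 0 := leadingCoeff_ne_zero.2 hs
  obtain ⟨G, hGg, ⟨β, hβ⟩, y, hy⟩ := hsrg α (by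
    rw [hα]
    obtain ⟨u, hu, h | h⟩ := hn
    · refine ⟨Units.mk0 (algebraMap E K u / Algebra.norm K (AdjoinRoot.mk s A)) (div_ne_zero (by simpa using hu) hNs), Or.inl ?_⟩
      change Algebra.norm K (AdjoinRoot.mk g A) = _
      rw [h] at hnorm
      simp only [Units.val_mk0]
      rw [div_pow, eq_div_iff (pow_ne_zero 2 hNs), ← hnorm, map_pow]
    · refine ⟨Units.mk0 (algebraMap E K u * s.leadingCoeff / Algebra.norm K (AdjoinRoot.mk s A)) (div_ne_zero (mul_ne_zero (by simpa using hu) hslc) hNs), Or.inr ?_⟩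
      change Algebra.norm K (AdjoinRoot.mk g A) = _
      rw [h, map_mul, hlc] at hnorm
      simp only [Units.val_mk0]
      rw [div_pow, ← mul_div_assoc, eq_div_iff (pow_ne_zero 2 hNs), ← hnorm, map_pow]
      ring)
  obtain ⟨y, rfl⟩ := Ideal.Quotient.mk_surjective y
  rw [← map_mul, mk_eq_iff] at hy
  obtain ⟨z, hz⟩ := hy
  have hGF : IsCoprime F G := (hGg.pow_left (m := n)).of_isCoprime_of_dvd_left hFn
  obtain ⟨b, hb⟩ := Ideal.Quotient.mk_surjective (β : K[X] ⧸ Ideal.span {g})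
  rw [hα, ← hb, ← map_pow, ← map_mul, mk_eq_iff] at hβ
  have hbg : IsCoprime g b := (isUnit_mk_iff g b).1 (hb ▸ β.isUnit)
  have hbF : IsCoprime F b := (hbg.pow_left (m := n)).of_isCoprime_of_dvd_left hFn
  obtain ⟨α', hα'⟩ := (isUnit_mk_iff F A).2 hcop
  obtain ⟨r, ⟨-, hr⟩, -⟩ := existsUnique_nilpotent_sub_and_aeval_eq_zero
    (R := K[X] ⧸ Ideal.span {F}) (S := K[X] ⧸ Ideal.span {F})
    (P := X ^ 2 - C ((↑α'⁻¹ : K[X] ⧸ Ideal.span {F}) * Ideal.Quotient.mk _ G))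
    (x := Ideal.Quotient.mk _ b) (by
      simp only [map_sub, map_pow, aeval_X, aeval_C, Algebra.algebraMap_self, RingHom.id_apply]
      refine ⟨n, ?_⟩
      have h1 : (Ideal.Quotient.mk (Ideal.span {F}) b) ^ 2 - ↑α'⁻¹ * Ideal.Quotient.mk (Ideal.span {F}) G
        = - ↑α'⁻¹ * (Ideal.Quotient.mk (Ideal.span {F}) (G - A * b ^ 2)) := by
        have h3 : (↑α'⁻¹ : K[X] ⧸ Ideal.span {F}) * ↑α' = 1 := α'.inv_mul
        rw [hα'] at h3
        rw [map_sub, map_mul, map_pow]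
        linear_combination (- (Ideal.Quotient.mk (Ideal.span {F}) b) ^ 2) * h3
      rw [h1, mul_pow, ← map_pow, Ideal.Quotient.eq_zero_iff_mem.2, mul_zero]
      rw [Ideal.mem_span_singleton]
      exact hFn.trans (pow_dvd_pow_of_dvd hβ n)) (by
      rw [derivative_sub, derivative_C, sub_zero, derivative_X_pow, map_mul, map_pow, aeval_X]
      refine IsUnit.mul ?_ ?_
      · have h3 : IsUnit (C (2 : K)) := isUnit_C.2 (isUnit_iff_ne_zero.2 h2E)
        have h4 := h3.map (Ideal.Quotient.mk (Ideal.span {F}))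
        rw [map_ofNat, map_ofNat] at h4
        simpa using h4
      · simpa using (isUnit_mk_iff F b).2 hbF)
  obtain ⟨r, rfl⟩ := Ideal.Quotient.mk_surjective r
  have hGr : F ∣ G - A * r ^ 2 := by
    rw [← mk_eq_iff, map_mul, map_pow, ← hα']
    simp only [map_sub, map_pow, aeval_X, aeval_C, Algebra.algebraMap_self, RingHom.id_apply] at hr
    have h3 : (↑α'⁻¹ : K[X] ⧸ Ideal.span {F}) * ↑α' = 1 := α'.inv_mul
    linear_combination (-(α' : K[X] ⧸ Ideal.span {F})) * hr - (Ideal.Quotient.mk (Ideal.span {F}) G) * h3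
  obtain ⟨t, ht⟩ := hGr
  obtain ⟨c, d, hcd⟩ := hGF
  exact ⟨G, r, t, y * s, z * s ^ 2, c, d, by linear_combination ht, by rw [hgs]; linear_combination s ^ 2 * hz, hcd⟩

theorem sq_lies_over {E R S : Type*} [Field E] [CommRing R] [CommRing S] [Algebra E R] [Algebra R S] [Algebra E S]
    [IsScalarTower E R S] (P : Ideal R) (Q : Ideal S) [P.IsMaximal] [Q.IsMaximal] [Q.LiesOver P]
    (d m : ℕ) (hm : 0 < m) (hd : Odd d) (hP : Module.finrank E (R ⧸ P) = m)
    (hQ : Module.finrank E (S ⧸ Q) = d * m) (f : R) (y : S) (hy : algebraMap R S f - y ^ 2 ∈ Q) :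
    ∃ w, f - w ^ 2 ∈ P := by
  let _ : Field (S ⧸ Q) := Ideal.Quotient.field _
  let _ : Field (R ⧸ P) := Ideal.Quotient.field _
  have : IsScalarTower E (R ⧸ P) (S ⧸ Q) := by
    refine IsScalarTower.of_algebraMap_eq fun x => ?_
    change Ideal.Quotient.mk _ (algebraMap E S x) = Ideal.Quotient.mk _ (algebraMap R S (algebraMap E R x))
    rw [← IsScalarTower.algebraMap_apply]
  have ht := Module.finrank_mul_finrank E (R ⧸ P) (S ⧸ Q)
  rw [hP, hQ, mul_comm d] at ht
  have hdd := Nat.eq_of_mul_eq_mul_left hm ht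
  obtain ⟨w, hw⟩ := isSquare_of_odd (k := R ⧸ P) (K := S ⧸ Q) (by rwa [hdd]) (Ideal.Quotient.mk P f) (by
    refine ⟨Ideal.Quotient.mk _ y, ?_⟩
    change Ideal.Quotient.mk _ (algebraMap R S f) = _
    rw [← map_mul, Ideal.Quotient.eq, ← sq]
    exact hy)
  obtain ⟨w, rfl⟩ := Ideal.Quotient.mk_surjective w
  refine ⟨w, ?_⟩
  rw [← map_mul, Ideal.Quotient.eq, ← sq] at hw
  exact hw

theorem exists_prime_below {R S : Type*} [CommRing R] [IsDomain R] [IsPrincipalIdealRing R]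
    [CommRing S] [IsDomain S] [IsPrincipalIdealRing S]
    [Algebra R S] [Module.Finite R S] [Module.Free R S] (π : S) (hπ : Prime π) :
    ∃ p : R, Prime p ∧ (Ideal.span {π}).under R = Ideal.span {p} ∧
      ∃ d, Associated (Algebra.norm R π) (p ^ d) := by
  have hmax : (Ideal.span {π}).IsMaximal :=
    PrincipalIdealRing.isMaximal_of_irreducible hπ.irreducible
  have hPbot : (Ideal.span {π}).under R ≠ ⊥ := Ideal.comap_ne_bot_of_integral_mem hπ.ne_zero
    (Ideal.mem_span_singleton_self π) (Algebra.IsIntegral.isIntegral π)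
  have hPp : ((Ideal.span {π}).under R).IsPrime := inferInstance
  obtain ⟨p, hp⟩ := (IsPrincipalIdealRing.principal ((Ideal.span {π}).under R)).principal
  rw [← Ideal.span] at hp
  have hp0 : p ≠ 0 := by rintro rfl; exact hPbot (by simp [hp])
  have hpp : Prime p := by
    rw [← Ideal.span_singleton_prime hp0, ← hp]; exact hPp
  have hdvd : π ∣ algebraMap R S p := by
    have : p ∈ (Ideal.span {π}).under R := by rw [hp]; exact Ideal.mem_span_singleton_self p
    rw [Ideal.under, Ideal.mem_comap, Ideal.mem_span_singleton] at this
    exact this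
  have hnd : Algebra.norm R π ∣ p ^ Module.finrank R S := by
    rw [← Algebra.norm_algebraMap (S := S)]; exact map_dvd _ hdvd
  obtain ⟨d, -, hd⟩ := (dvd_prime_pow hpp _).1 hnd
  exact ⟨p, hpp, hp, d, hd⟩

theorem step_prime {E S : Type*} [Field E] [CommRing S] [IsDomain S] [IsPrincipalIdealRing S]
    [Algebra E[X] S] [Algebra E S] [IsScalarTower E E[X] S] [Module.Finite E[X] S] [Module.Free E[X] S]
    (f : E[X]) (π : S) (hπ : Prime π) (y : S) (hy : π ∣ algebraMap E[X] S f - y ^ 2) :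
    ∃ p : E[X], Prime p ∧ ∃ d, Associated (Algebra.norm E[X] π) (p ^ d) ∧ (Odd d → ∃ y, p ∣ f - y ^ 2) := by
  obtain ⟨p, hpp, hp, d, hd⟩ := exists_prime_below (R := E[X]) π hπ
  refine ⟨p, hpp, d, hd, fun hodd => ?_⟩
  have hmax : (Ideal.span {π}).IsMaximal :=
    PrincipalIdealRing.isMaximal_of_irreducible hπ.irreducible
  have hPmax : (Ideal.span {p}).IsMaximal :=
    PrincipalIdealRing.isMaximal_of_irreducible hpp.irreducible
  have hlies : (Ideal.span {π}).LiesOver (Ideal.span {p}) := ⟨hp.symm⟩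
  have hK := finrank_quotient_span_eq_natDegree_norm (F := E) (Module.Free.chooseBasis E[X] S) hπ.ne_zero
  rw [natDegree_eq_of_degree_eq (degree_eq_degree_of_associated hd), natDegree_pow] at hK
  obtain ⟨w, hw⟩ := sq_lies_over (E := E) (Ideal.span {p}) (Ideal.span {π}) d p.natDegree
    hpp.irreducible.natDegree_pos hodd finrank_quotient_span_eq_natDegree hK f y
    (Ideal.mem_span_singleton.2 hy)
  exact ⟨w, Ideal.mem_span_singleton.1 hw⟩

theorem sq_crt {R : Type*} [CommRing R] (f p g y z : R) (h : IsCoprime p g) (hy : p ∣ f - y ^ 2) (hz : g ∣ f - z ^ 2) :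
    ∃ w, p * g ∣ f - w ^ 2 := by
  obtain ⟨a, b, hab⟩ := h
  refine ⟨b * g * y + a * p * z, IsCoprime.mul_dvd ⟨a, b, hab⟩ ?_ ?_⟩
  · have : f - (b * g * y + a * p * z) ^ 2 = (f - y ^ 2) + p * (a * y * (y + (b * g * y + a * p * z)) - a * z * (y + (b * g * y + a * p * z))) := by
      have hb : b * g = 1 - a * p := by linear_combination hab
      rw [hb]; ring
    rw [this]; exact dvd_add hy (Dvd.intro _ rfl)
  · have : f - (b * g * y + a * p * z) ^ 2 = (f - z ^ 2) + g * (b * z * (z + (b * g * y + a * p * z)) - b * y * (z + (b * g * y + a * p * z))) := by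
      have hb : a * p = 1 - b * g := by linear_combination hab
      rw [hb]; ring
    rw [this]; exact dvd_add hz (Dvd.intro _ rfl)

theorem norm_decomp {E S : Type*} [Field E] [CommRing S] [IsDomain S] [IsPrincipalIdealRing S]
    [Algebra E[X] S] [Algebra E S] [IsScalarTower E E[X] S] [Module.Finite E[X] S] [Module.Free E[X] S]
    (f : E[X]) (y : S) (G : S) : G ≠ 0 → G ∣ algebraMap E[X] S f - y ^ 2 →
    ∃ g s w : E[X], Algebra.norm E[X] G = g * s ^ 2 ∧ g ∣ f - w ^ 2 := by
  induction G using UniqueFactorizationMonoid.induction_on_prime with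
  | h₁ => intro h; exact absurd rfl h
  | h₂ x hx =>
    intro _ _
    exact ⟨Algebra.norm E[X] x, 1, 0, by simp, (hx.map (Algebra.norm E[X])).dvd⟩
  | h₃ G π hG hπ ih =>
    intro _ hd
    obtain ⟨g, s, w, h1, h2⟩ := ih hG ((Dvd.intro_left _ rfl).trans hd)
    obtain ⟨p, hp, d, ⟨u, hu⟩, hsq⟩ := step_prime f π hπ y ((Dvd.intro _ rfl).trans hd)
    have hu' : Algebra.norm E[X] π = p ^ d * (↑u⁻¹ : E[X]) := by
      rw [← hu, mul_assoc, Units.mul_inv, mul_one]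
    rw [map_mul, h1, hu']
    rcases Nat.even_or_odd' d with ⟨m, rfl | rfl⟩
    · refine ⟨↑u⁻¹ * g, p ^ m * s, w, by ring, ?_⟩
      exact (Units.mul_left_dvd).2 h2
    · obtain ⟨v, hv⟩ := hsq ⟨m, rfl⟩
      by_cases hpg : p ∣ g
      · obtain ⟨g1, rfl⟩ := hpg
        refine ⟨↑u⁻¹ * g1, p ^ (m + 1) * s, w, by ring, ?_⟩
        exact (Units.mul_left_dvd).2 ((Dvd.intro_left _ rfl).trans h2)
      · obtain ⟨w', hw'⟩ := sq_crt f p g v w ((hp.irreducible.coprime_iff_not_dvd).2 hpg) hv h2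
        refine ⟨↑u⁻¹ * (p * g), p ^ m * s, w', by ring, ?_⟩
        exact (Units.mul_left_dvd).2 hw'

theorem norm_congr {R S : Type*} [CommRing R] [CommRing S] [Algebra R S] [Module.Finite R S] [Module.Free R S]
    (f : R) (x t : S) : f ∣ Algebra.norm R (x + algebraMap R S f * t) - Algebra.norm R x := by
  classical
  let b := Module.Free.chooseBasis R S
  rw [Algebra.norm_eq_matrix_det b, Algebra.norm_eq_matrix_det b, ← Ideal.mem_span_singleton, ← Ideal.Quotient.eq,
    RingHom.map_det, RingHom.map_det, map_add, map_mul, AlgHom.commutes, ← Algebra.smul_def]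
  congr 1
  ext i j
  simp only [RingHom.mapMatrix_apply, Matrix.map_apply, Matrix.add_apply, Matrix.smul_apply, smul_eq_mul, map_add, map_mul]
  rw [Ideal.Quotient.eq_zero_iff_mem.2 (Ideal.mem_span_singleton_self f)]
  simp

theorem descent {E S : Type*} [Field E] [CommRing S] [IsDomain S] [IsPrincipalIdealRing S]
    [Algebra E[X] S] [Algebra E S] [IsScalarTower E E[X] S] [Module.Finite E[X] S] [Module.Free E[X] S]
    (hodd : Odd (Module.finrank E[X] S)) (f a : E[X]) (G β t y z c d : S) (hG0 : G ≠ 0)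
    (h1 : G = algebraMap E[X] S a * β ^ 2 + algebraMap E[X] S f * t)
    (h2 : algebraMap E[X] S f = y ^ 2 + G * z) (h3 : c * algebraMap E[X] S f + d * G = 1) :
    ∃ g b w : E[X], IsCoprime f g ∧ f ∣ g - a * b ^ 2 ∧ g ∣ f - w ^ 2 := by
  obtain ⟨g, s, w, hg, hw⟩ := norm_decomp f y G hG0 ⟨z, by rw [h2]; ring⟩
  obtain ⟨n, hn⟩ := hodd
  have hc1 : f ∣ Algebra.norm E[X] d * Algebra.norm E[X] G - 1 := by
    have := norm_congr f 1 (-c : S)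
    rw [show (1 : S) + algebraMap E[X] S f * (-c) = d * G by linear_combination -h3, map_mul, map_one] at this
    exact this
  have hc2 : f ∣ Algebra.norm E[X] G - a ^ (2 * n + 1) * Algebra.norm E[X] β ^ 2 := by
    have := norm_congr f (algebraMap E[X] S a * β ^ 2) t
    rw [← h1, map_mul, map_pow, Algebra.norm_algebraMap, hn] at this
    exact this
  rw [hg] at hc1 hc2
  obtain ⟨k, hk⟩ := hc1
  obtain ⟨l, hl⟩ := hc2
  set D := Algebra.norm E[X] d
  set B := Algebra.norm E[X] β
  -- inverse of s modulo f is `D * g * s`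
  refine ⟨g, a ^ n * B * (D * g * s), w, ⟨-k, D * s ^ 2, by linear_combination hk⟩, ?_, hw⟩
  -- D g s^2 = 1 + f k
  have hs : D * g * s ^ 2 = 1 + f * k := by linear_combination hk
  have hB : a ^ (2 * n + 1) * B ^ 2 = g * s ^ 2 - f * l := by linear_combination -hl
  have : g - a * (a ^ n * B * (D * g * s)) ^ 2 = g - (a ^ (2 * n + 1) * B ^ 2) * (D * g * s) ^ 2 := by ring
  rw [this, hB]
  have h5 : g - (g * s ^ 2 - f * l) * (D * g * s) ^ 2 = g - g * (D * g * s ^ 2) ^ 2 + f * (l * (D * g * s) ^ 2) := by ring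
  rw [h5, hs]
  exact ⟨-g * (2 * k + f * k ^ 2) + l * (D * g * s) ^ 2, by ring⟩

attribute [local instance] Polynomial.algebra

theorem finrank_poly (E F : Type*) [Field E] [Field F] [Algebra E F] [FiniteDimensional E F] :
    Module.Finite E[X] F[X] ∧ Module.Free E[X] F[X] ∧ Module.finrank E[X] F[X] = Module.finrank E F := by
  have h : Algebra.IsPushout E E[X] F F[X] := inferInstance
  have e := h.equiv.toLinearEquiv
  refine ⟨Module.Finite.equiv e, Module.Free.of_equiv e, ?_⟩
  rw [← e.finrank_eq, Module.finrank_baseChange]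

theorem statement_core {E : Type*} [Field E] (hchar : ringChar E ≠ 2)
    {E' : Type*} [Field E'] [Algebra E E'] (halg : Algebra.IsAlgebraic E E')
    (hodd : ∀ x : E', Odd ((minpoly E x).natDegree))
    (f a : E[X]) (hfu : ¬ IsUnit f) (G β t y z c d : E'[X])
    (h1 : G = a.map (algebraMap E E') * β ^ 2 + f.map (algebraMap E E') * t)
    (h2 : f.map (algebraMap E E') = y ^ 2 + G * z) (h3 : c * f.map (algebraMap E E') + d * G = 1) :
    ∃ g b w : E[X], IsCoprime f g ∧ f ∣ g - a * b ^ 2 ∧ g ∣ f - w ^ 2 := by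
  classical
  let T : Finset E' := G.coeffs ∪ β.coeffs ∪ t.coeffs ∪ y.coeffs ∪ z.coeffs ∪ c.coeffs ∪ d.coeffs
  obtain ⟨F, hfin, hlift⟩ : ∃ F : IntermediateField E E', FiniteDimensional E F ∧
      ∀ q : E'[X], q.coeffs ⊆ T → ∃ r : F[X], r.map (algebraMap F E') = q := by
    refine ⟨IntermediateField.adjoin E (T : Set E'),
      IntermediateField.finiteDimensional_adjoin fun x _ => Algebra.IsIntegral.isIntegral x, ?_⟩
    intro q hq
    rw [← Polynomial.mem_lifts, Polynomial.lifts_iff_coeff_lifts]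
    intro n
    by_cases h0 : q.coeff n = 0
    · rw [h0]; exact ⟨0, map_zero _⟩
    · exact ⟨⟨q.coeff n, IntermediateField.subset_adjoin _ _ (hq (Polynomial.coeff_mem_coeffs h0))⟩, rfl⟩
  obtain ⟨G, rfl⟩ := hlift G (by intro x hx; simp only [T, Finset.mem_union]; tauto)
  obtain ⟨β, rfl⟩ := hlift β (by intro x hx; simp only [T, Finset.mem_union]; tauto)
  obtain ⟨t, rfl⟩ := hlift t (by intro x hx; simp only [T, Finset.mem_union]; tauto)
  obtain ⟨y, rfl⟩ := hlift y (by intro x hx; simp only [T, Finset.mem_union]; tauto)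
  obtain ⟨z, rfl⟩ := hlift z (by intro x hx; simp only [T, Finset.mem_union]; tauto)
  obtain ⟨c, rfl⟩ := hlift c (by intro x hx; simp only [T, Finset.mem_union]; tauto)
  obtain ⟨d, rfl⟩ := hlift d (by intro x hx; simp only [T, Finset.mem_union]; tauto)
  clear hlift
  have hinj : Function.Injective (Polynomial.map (algebraMap F E')) :=
    Polynomial.map_injective _ (algebraMap F E').injective
  have hmap : ∀ q : E[X], q.map (algebraMap E E') = (q.map (algebraMap E F)).map (algebraMap F E') := by
    intro q; rw [Polynomial.map_map, ← IsScalarTower.algebraMap_eq]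
  rw [hmap, hmap f, ← Polynomial.map_pow, ← Polynomial.map_mul, ← Polynomial.map_mul, ← Polynomial.map_add] at h1
  rw [hmap f, ← Polynomial.map_pow, ← Polynomial.map_mul, ← Polynomial.map_add] at h2
  rw [hmap f, ← Polynomial.map_mul, ← Polynomial.map_mul, ← Polynomial.map_add, ← Polynomial.map_one (algebraMap F E')] at h3
  replace h1 := hinj h1
  replace h2 := hinj h2
  replace h3 := hinj h3
  obtain ⟨i1, i2, i3⟩ := finrank_poly E F
  have hoddF : Odd (Module.finrank E F) := odd_finrank hchar fun x => by
    have := hodd (x : E')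
    rwa [show minpoly E (x : E') = minpoly E x from
      minpoly.algebraMap_eq (B' := E') (algebraMap F E').injective x] at this
  have hG0 : G ≠ 0 := by
    rintro rfl
    rw [mul_zero, add_zero] at h3
    have : IsUnit (f.map (algebraMap E F)) := IsUnit.of_mul_eq_one_right _ h3
    exact hfu ((Polynomial.isUnit_map _).1 this)
  exact descent (by rwa [i3]) f a G β t y z c d hG0 h1 h2 h3

/-- Square-reflexivity descends along algebraic extensions all of whose elements have
odd degree over the base field. -/
theorem statement19 (E : Type*) [Field E] (hchar : ringChar E ≠ 2)
    (E' : Type*) [Field E'] [Algebra E E'] (halg : Algebra.IsAlgebraic E E')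
    (hodd : ∀ x : E', Odd ((minpoly E x).natDegree))
    (hsr : ∀ g : Polynomial E', Squarefree g → IsSquareReflexive g)
    (f : Polynomial E) (hf : Squarefree f) :
    IsSquareReflexive f := by

  refine ⟨hf, fun α hα => ?_⟩
  obtain ⟨a, ha⟩ := Ideal.Quotient.mk_surjective (α : E[X] ⧸ Ideal.span {f})
  have hca : IsCoprime f a := (isUnit_mk_iff f a).1 (ha ▸ α.isUnit)
  by_cases hfu : IsUnit f
  · refine ⟨1, isCoprime_one_right, ⟨1, ?_⟩, 0, ?_⟩
    · rw [← ha, Units.val_one, one_pow, mul_one, mk_eq_iff]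
      exact hfu.dvd
    · rw [← map_zero (Ideal.Quotient.mk _), ← map_mul, mk_eq_iff]
      exact one_dvd _
  obtain ⟨G, β, t, y, z, c, d, h1, h2, h3⟩ := over_ext hchar hsr f hf a hca (by
    obtain ⟨u, hu⟩ := hα
    rw [← ha] at hu
    exact ⟨u, u.ne_zero, hu⟩)
  obtain ⟨g, b, w, hg, hb, hw⟩ := statement_core hchar halg hodd f a hfu G β t y z c d h1 h2 h3
  have hab : IsCoprime f (a * b ^ 2) := by
    obtain ⟨k, hk⟩ := hb
    obtain ⟨x, x', hx⟩ := hg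
    exact ⟨x + x' * k, x', by linear_combination hx - x' * hk⟩
  have hcb : IsCoprime f b := by
    rw [sq, ← mul_assoc] at hab
    exact hab.of_mul_right_right
  obtain ⟨B, hB⟩ := (isUnit_mk_iff f b).2 hcb
  refine ⟨g, hg, ⟨B, ?_⟩, Ideal.Quotient.mk _ w, ?_⟩
  · rw [hB, ← ha, ← map_pow, ← map_mul, mk_eq_iff]
    exact hb
  · rw [← map_mul, mk_eq_iff, ← sq]
    exact hw
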